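/- Let ξ ∈ ℝ with 0 < ξ < α, and let u ∈ C²([0,R)) be the solution of the Cauchy problem M⁻(u'') + g(u) = 0, u(0) = ξ, u'(0) = 0 on its maximal interval of existence [0,R). Then R = +∞, u is oscillating (it has an unbounded sequence of zeros), u is periodic (there exists T > 0 with u(r+T) = u(r) for all r ≥ 0), and sup_{r ≥ 0} |u(r)| = ξ. -/

import Mathlib

open Set Filter Topology

theorem exists_global_hasDerivAt_of_forall_Ioo {E : Type*} [NormedAddCommGroup E]
    [NormedSpace ℝ E] {f : E → E} {K : NNReal} (hf : LipschitzWith K f) (x₀ : E)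
    (h : ∀ T : ℝ, 0 < T → ∃ γ : ℝ → E, γ 0 = x₀ ∧ ∀ t ∈ Ioo (-T) T, HasDerivAt γ (f (γ t)) t) :
    ∃ γ : ℝ → E, γ 0 = x₀ ∧ ∀ t, HasDerivAt γ (f (γ t)) t := by
  have hpos : ∀ t : ℝ, 0 < |t| + 1 := fun t => by positivity
  choose! γ hγ0 hγ using h
  have key : ∀ S T : ℝ, 0 < S → S ≤ T → EqOn (γ S) (γ T) (Ioo (-S) S) := by
    intro S T hS hST
    refine ODE_solution_unique_of_mem_Ioo (t₀ := 0) (v := fun _ => f) (s := fun _ => univ)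
      (K := K) (fun t _ => hf.lipschitzOnWith) ⟨by linarith, hS⟩
      (fun t ht => ⟨hγ S hS t ht, trivial⟩)
      (fun t ht => ⟨hγ T (hS.trans_le hST) t ⟨by linarith [ht.1], by linarith [ht.2]⟩, trivial⟩) ?_
    rw [hγ0 S hS, hγ0 T (hS.trans_le hST)]
  have hmem : ∀ t : ℝ, t ∈ Ioo (-(|t| + 1)) (|t| + 1) := fun t =>
    ⟨by linarith [neg_abs_le t], by linarith [le_abs_self t]⟩
  refine ⟨fun t => γ (|t| + 1) t, by simpa using hγ0 1 one_pos, fun t => ?_⟩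
  have hd := hγ (|t| + 2) (by positivity) t ⟨by linarith [neg_abs_le t], by linarith [le_abs_self t]⟩
  have heq : (fun s => γ (|s| + 1) s) =ᶠ[𝓝 t] γ (|t| + 2) := by
    have : ∀ᶠ s in 𝓝 t, |s| < |t| + 1 :=
      (continuous_abs.tendsto t).eventually (gt_mem_nhds (by linarith))
    filter_upwards [this] with s hs
    exact key _ _ (hpos s) (by linarith) (hmem s)
  have := hd.congr_of_eventuallyEq heq
  rwa [← heq.self_of_nhds] at this

theorem exists_hasDerivAt_Ioo_of_bounded_lipschitz {E : Type*} [NormedAddCommGroup E]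
    [NormedSpace ℝ E] [CompleteSpace E] {f : E → E} {K L : NNReal} (hf : LipschitzWith K f)
    (hL : ∀ x, ‖f x‖ ≤ L) (x₀ : E) {T : ℝ} (hT : 0 < T) :
    ∃ γ : ℝ → E, γ 0 = x₀ ∧ ∀ t ∈ Ioo (-T) T, HasDerivAt γ (f (γ t)) t := by
  have hP : IsPicardLindelof (fun _ => f) (tmin := -T) (tmax := T) ⟨0, by linarith, hT.le⟩ x₀
      (L * T.toNNReal) 0 L K :=
    { lipschitzOnWith := fun t _ => hf.lipschitzOnWith
      continuousOn := fun x _ => continuousOn_const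
      norm_le := fun t _ x _ => hL x
      mul_max_le := by simp [hT.le] }
  obtain ⟨γ, h0, hγ⟩ := hP.exists_eq_forall_mem_Icc_hasDerivWithinAt₀
  exact ⟨γ, h0, fun t ht => (hγ t (Ioo_subset_Icc_self ht)).hasDerivAt (Icc_mem_nhds ht.1 ht.2)⟩

theorem lipschitzWith_newton_field {q : ℝ → ℝ} {K : NNReal} (hq : LipschitzWith K q) :
    LipschitzWith (max 1 K) fun z : ℝ × ℝ => (z.2, -q z.1) :=
  LipschitzWith.prod_snd.prodMk (mul_one K ▸ (hq.comp (LipschitzWith.prod_fst (β := ℝ))).neg)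

theorem exists_global_newton {q : ℝ → ℝ} {K C : NNReal} (hq : LipschitzWith K q)
    (hC : ∀ x, |q x| ≤ C) (ξ : ℝ) :
    ∃ u w : ℝ → ℝ, u 0 = ξ ∧ w 0 = 0 ∧ (∀ t, HasDerivAt u (w t) t) ∧
      ∀ t, HasDerivAt w (-q (u t)) t := by
  obtain ⟨γ, h0, hγ⟩ := exists_global_hasDerivAt_of_forall_Ioo
      (lipschitzWith_newton_field hq) ((ξ, 0) : ℝ × ℝ) (by
    intro T hT
    set M : NNReal := C * T.toNNReal + 1 with hM
    have hMr : (M : ℝ) = C * T + 1 := by simp [hM, hT.le]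
    have hcl : LipschitzWith 1 fun z : ℝ × ℝ => max (-(M : ℝ)) (min z.2 M) :=
      (LipschitzWith.prod_snd.min_const _).const_max _
    have hF : LipschitzWith (max 1 K) fun z : ℝ × ℝ => (max (-(M : ℝ)) (min z.2 M), -q z.1) :=
      hcl.prodMk (mul_one K ▸ (hq.comp (LipschitzWith.prod_fst (β := ℝ))).neg)
    obtain ⟨γ, h0, hγ⟩ := exists_hasDerivAt_Ioo_of_bounded_lipschitz (L := max M C) hF (by
      intro z
      rw [Prod.norm_def, NNReal.coe_max]
      refine max_le_max ?_ (by simpa using hC z.1)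
      exact abs_le.2 ⟨le_max_left _ _, max_le (by simp) (min_le_right _ _)⟩) (ξ, 0) hT
    refine ⟨γ, h0, fun t ht => ?_⟩
    have hw : ∀ s ∈ Ioo (-T) T, HasDerivAt (fun s => (γ s).2) (-q (γ s).1) s := fun s hs =>
      (hγ s hs).snd
    have hb : ‖(γ t).2 - (γ 0).2‖ ≤ C * ‖t - 0‖ :=
      (convex_Ioo (-T) T).norm_image_sub_le_of_norm_hasDerivWithin_le
        (fun s hs => (hw s hs).hasDerivWithinAt) (fun s _ => by simpa using hC (γ s).1)
        ⟨by linarith, hT⟩ ht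
    rw [h0] at hb
    simp only [sub_zero, Real.norm_eq_abs] at hb
    have htT : |t| ≤ T := abs_le.2 ⟨ht.1.le, ht.2.le⟩
    have hb' : |(γ t).2| ≤ M := by
      rw [hMr]
      nlinarith [mul_le_mul_of_nonneg_left htT C.coe_nonneg]
    have := hγ t ht
    rwa [min_eq_left (abs_le.1 hb').2, max_eq_right (abs_le.1 hb').1] at this)
  exact ⟨fun t => (γ t).1, fun t => (γ t).2, by simp [h0], by simp [h0], fun t => (hγ t).fst,
    fun t => (hγ t).snd⟩

theorem newton_unique {q u w v z : ℝ → ℝ} {K : NNReal} (hq : LipschitzWith K q) {t₀ : ℝ}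
    (hu : ∀ t, HasDerivAt u (w t) t) (hw : ∀ t, HasDerivAt w (-q (u t)) t)
    (hv : ∀ t, HasDerivAt v (z t) t) (hz : ∀ t, HasDerivAt z (-q (v t)) t)
    (huv : u t₀ = v t₀) (hwz : w t₀ = z t₀) : u = v := by
  have h := ODE_solution_unique_univ (t₀ := t₀) (v := fun _ (z : ℝ × ℝ) => (z.2, -q z.1))
    (s := fun _ => univ) (f := fun t => (u t, w t)) (g := fun t => (v t, z t))
    (fun _ => (lipschitzWith_newton_field hq).lipschitzOnWith)
    (fun t => ⟨(hu t).prodMk (hw t), trivial⟩) (fun t => ⟨(hv t).prodMk (hz t), trivial⟩)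
    (by simp [huv, hwz])
  exact funext fun t => congrArg Prod.fst (congrFun h t)

theorem newton_reflect {q u w : ℝ → ℝ} {K : NNReal} (hq : LipschitzWith K q) {t₀ : ℝ}
    (hu : ∀ t, HasDerivAt u (w t) t) (hw : ∀ t, HasDerivAt w (-q (u t)) t)
    (h0 : w t₀ = 0) (t : ℝ) : u (2 * t₀ - t) = u t := by
  have h := newton_unique hq (t₀ := t₀) (v := fun t => u (2 * t₀ - t))
    (z := fun t => -w (2 * t₀ - t)) hu hw
    (fun t => by simpa using (hu (2 * t₀ - t)).comp_const_sub (2 * t₀) t)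
    (fun t => by simpa using! ((hw (2 * t₀ - t)).comp_const_sub (2 * t₀) t).neg)
    (by ring_nf) (by simp [two_mul, h0])
  exact (congrFun h t).symm

theorem newton_abs_le {q u w : ℝ → ℝ} (hq : Continuous q) (hpos : ∀ s, 0 < s → 0 < q s)
    (hodd : ∀ s, 0 ≤ s → q (-s) ≤ -q s) {ξ : ℝ} (hξ : 0 < ξ) (hu0 : u 0 = ξ) (hw0 : w 0 = 0)
    (hu : ∀ t, HasDerivAt u (w t) t) (hw : ∀ t, HasDerivAt w (-q (u t)) t) (t : ℝ) :
    |u t| ≤ ξ := by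
  set Q : ℝ → ℝ := fun x => ∫ s in (0 : ℝ)..x, q s
  have hQ : ∀ x, HasDerivAt Q (q x) x := fun x =>
    intervalIntegral.integral_hasDerivAt_right (hq.intervalIntegrable _ _)
      (hq.stronglyMeasurableAtFilter _ _) hq.continuousAt
  have hQc : Continuous Q := continuous_iff_continuousAt.2 fun x => (hQ x).continuousAt
  have hmono : StrictMonoOn Q (Ici 0) := by
    refine strictMonoOn_of_deriv_pos (convex_Ici 0) hQc.continuousOn fun x hx => ?_
    rw [interior_Ici] at hx
    rw [(hQ x).deriv]
    exact hpos x hx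
  have hD : ∀ x, HasDerivAt (fun x => Q (-x) - Q x) (-q (-x) - q x) x := fun x => by
    have h1 : HasDerivAt (fun x => Q (-x)) (-q (-x)) x := by
      simpa using! (hQ (-x)).comp x (hasDerivAt_neg x)
    exact h1.sub (hQ x)
  have hcmp : ∀ x, 0 ≤ x → Q x ≤ Q (-x) := by
    intro x hx
    have hm : MonotoneOn (fun x => Q (-x) - Q x) (Ici 0) := by
      refine monotoneOn_of_deriv_nonneg (convex_Ici 0)
        (continuous_iff_continuousAt.2 fun x => (hD x).continuousAt).continuousOn
        (fun x _ => (hD x).differentiableAt.differentiableWithinAt) fun x hx => ?_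
      rw [interior_Ici] at hx
      rw [(hD x).deriv]
      linarith [hodd x (le_of_lt hx)]
    have := hm self_mem_Ici hx hx
    simpa using this
  have hE : ∀ t, HasDerivAt (fun t => w t ^ 2 / 2 + Q (u t)) 0 t := fun t => by
    have := (((hw t).pow 2).div_const 2).add ((hQ (u t)).comp t (hu t))
    exact this.congr_deriv (by simp; ring)
  have hconst := is_const_of_deriv_eq_zero (fun t => (hE t).differentiableAt)
    (fun t => (hE t).deriv) t 0
  simp only [hu0, hw0] at hconst
  have hle : Q (u t) ≤ Q ξ := by nlinarith [sq_nonneg (w t)]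
  by_contra! hlt
  have h1 : Q ξ < Q |u t| := hmono (mem_Ici.2 hξ.le) (mem_Ici.2 (abs_nonneg _)) hlt
  have h2 : Q |u t| ≤ Q (u t) := by
    rcases abs_cases (u t) with ⟨h, _⟩ | ⟨h, _⟩
    · rw [h]
    · rw [h]
      simpa using hcmp (-u t) (by linarith)
  linarith

theorem newton_exists_zero {q u w : ℝ → ℝ} (hpos : ∀ s, 0 < s → 0 < q s)
    {ξ : ℝ} (hξ : 0 < ξ) (hu0 : u 0 = ξ) (hw0 : w 0 = 0)
    (hu : ∀ t, HasDerivAt u (w t) t) (hw : ∀ t, HasDerivAt w (-q (u t)) t) :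
    ∃ t, 0 < t ∧ u t = 0 := by
  have huc : Continuous u := continuous_iff_continuousAt.2 fun x => (hu x).continuousAt
  have hwc : Continuous w := continuous_iff_continuousAt.2 fun x => (hw x).continuousAt
  by_contra! hne
  have hup : ∀ t, 0 ≤ t → 0 < u t := by
    intro t ht
    by_contra! hle
    obtain ⟨s, hs, hs0⟩ := intermediate_value_Icc' ht huc.continuousOn
      ⟨hle, by rw [hu0]; exact hξ.le⟩
    rcases hs.1.eq_or_lt with rfl | h
    · linarith
    · exact hne s h hs0
  have hwa : StrictAntiOn w (Ici 0) := by
    refine strictAntiOn_of_deriv_neg (convex_Ici 0) hwc.continuousOn fun x hx => ?_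
    rw [interior_Ici] at hx
    rw [(hw x).deriv]
    linarith [hpos _ (hup x (le_of_lt hx))]
  have hw1 : w 1 < 0 := hw0 ▸ hwa self_mem_Ici (mem_Ici.2 zero_le_one) one_pos
  have hlin : ∀ t, 1 ≤ t → u t - u 1 ≤ w 1 * (t - 1) := fun t ht =>
    (convex_Icc 1 t).image_sub_le_mul_sub_of_deriv_le huc.continuousOn
      (fun x _ => (hu x).differentiableAt.differentiableWithinAt)
      (fun x hx => by
        rw [interior_Icc] at hx
        rw [(hu x).deriv]
        exact hwa.antitoneOn (mem_Ici.2 zero_le_one) (mem_Ici.2 (by linarith [hx.1])) hx.1.le)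
      1 ⟨le_rfl, ht⟩ t ⟨ht, le_rfl⟩ ht
  have hpos' : 0 < u 1 / (-w 1) := div_pos (hup 1 zero_le_one) (by linarith)
  have h1 := hlin (1 + u 1 / (-w 1)) (by linarith)
  have h2 : w 1 * (1 + u 1 / (-w 1) - 1) = -u 1 := by field_simp [hw1.ne]; ring
  linarith [hup (1 + u 1 / (-w 1)) (by linarith)]

theorem newton_exists_turning {q u w : ℝ → ℝ} (hq : Continuous q)
    (hpos : ∀ s, 0 < s → 0 < q s) (hodd : ∀ s, 0 ≤ s → q (-s) ≤ -q s)
    {ξ : ℝ} (hξ : 0 < ξ) (hu0 : u 0 = ξ) (hw0 : w 0 = 0)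
    (hu : ∀ t, HasDerivAt u (w t) t) (hw : ∀ t, HasDerivAt w (-q (u t)) t) :
    ∃ t, 0 < t ∧ w t = 0 := by
  have huc : Continuous u := continuous_iff_continuousAt.2 fun x => (hu x).continuousAt
  have hwc : Continuous w := continuous_iff_continuousAt.2 fun x => (hw x).continuousAt
  have hbd := newton_abs_le hq hpos hodd hξ hu0 hw0 hu hw
  obtain ⟨t₀, ht₀, hut₀⟩ := newton_exists_zero hpos hξ hu0 hw0 hu hw
  by_contra! hne
  have hwn : ∀ t, 0 < t → w t < 0 := by
    by_contra! hex
    obtain ⟨t, ht, hwt⟩ := hex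
    have hall : ∀ s, 0 < s → 0 < w s := by
      intro s hs
      by_contra! hle
      obtain ⟨r, hr, hr0⟩ := (isPreconnected_Ioi (a := (0 : ℝ))).intermediate_value hs ht
        hwc.continuousOn ⟨hle, hwt⟩
      exact hne r hr hr0
    have hm : StrictMonoOn u (Ici 0) := by
      refine strictMonoOn_of_deriv_pos (convex_Ici 0) huc.continuousOn fun x hx => ?_
      rw [interior_Ici] at hx
      rw [(hu x).deriv]
      exact hall x hx
    have := hm self_mem_Ici (mem_Ici.2 zero_le_one) one_pos
    rw [hu0] at this
    linarith [(abs_le.1 (hbd 1)).2]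
  have hua : StrictAntiOn u (Ici 0) := by
    refine strictAntiOn_of_deriv_neg (convex_Ici 0) huc.continuousOn fun x hx => ?_
    rw [interior_Ici] at hx
    rw [(hu x).deriv]
    exact hwn x hx
  set a := t₀ + 1 with ha
  have hua0 : u a < 0 := hut₀ ▸ hua (mem_Ici.2 ht₀.le) (mem_Ici.2 (by linarith)) (by linarith)
  have hξa : -ξ ≤ u a := (abs_le.1 (hbd a)).1
  obtain ⟨m, hm, hmin⟩ := isCompact_Icc.exists_isMaxOn (nonempty_Icc.2 hξa) hq.continuousOn
  have hqm : q m < 0 := by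
    have h1 := hpos (-m) (by linarith [hm.2])
    have h2 := hodd (-m) (by linarith [hm.2])
    rw [neg_neg] at h2
    linarith
  have hlin : ∀ t, a ≤ t → -q m * (t - a) ≤ w t - w a := fun t ht =>
    (convex_Icc a t).mul_sub_le_image_sub_of_le_deriv hwc.continuousOn
      (fun x _ => (hw x).differentiableAt.differentiableWithinAt)
      (fun x hx => by
        rw [interior_Icc] at hx
        rw [(hw x).deriv]
        have : q (u x) ≤ q m := hmin ⟨(abs_le.1 (hbd x)).1,
          hua.antitoneOn (mem_Ici.2 (by linarith)) (mem_Ici.2 (by linarith [hx.1])) hx.1.le⟩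
        linarith)
      a ⟨le_rfl, ht⟩ t ⟨ht, le_rfl⟩ ht
  have hwa : w a < 0 := hwn a (by linarith)
  have hp : 0 < w a / q m := div_pos_of_neg_of_neg hwa hqm
  have h1 := hlin (a + w a / q m) (by linarith)
  have h2 : -q m * (a + w a / q m - a) = -w a := by field_simp [hqm.ne]; ring
  linarith [hwn (a + w a / q m) (by linarith)]

theorem newton_periodic {q u w : ℝ → ℝ} {K : NNReal} (hq : LipschitzWith K q)
    (hpos : ∀ s, 0 < s → 0 < q s) (hodd : ∀ s, 0 ≤ s → q (-s) ≤ -q s)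
    {ξ : ℝ} (hξ : 0 < ξ) (hu0 : u 0 = ξ) (hw0 : w 0 = 0)
    (hu : ∀ t, HasDerivAt u (w t) t) (hw : ∀ t, HasDerivAt w (-q (u t)) t) :
    ∃ T, 0 < T ∧ Function.Periodic u T := by
  obtain ⟨t₁, ht₁, hwt₁⟩ := newton_exists_turning hq.continuous hpos hodd hξ hu0 hw0 hu hw
  refine ⟨2 * t₁, by linarith, fun t => ?_⟩
  have h1 := newton_reflect hq hu hw hwt₁ (-t)
  have h2 := newton_reflect hq hu hw hw0 t
  rw [mul_zero, zero_sub] at h2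
  rw [← h2, ← h1]
  ring_nf

/-- The unique `p` such that the Pucci minimal operator satisfies `M⁻(-p) + y = 0`. -/
noncomputable def pucciResponse (lam Lam y : ℝ) : ℝ := max y 0 / Lam + min y 0 / lam

section pucciResponse

variable {lam Lam : ℝ}

theorem pucci_add_eq_zero_iff (hlam : 0 < lam) (hLam : 0 < Lam) (a y : ℝ) :
    (if 0 ≤ a then lam * a else Lam * a) + y = 0 ↔ a = -pucciResponse lam Lam y := by
  unfold pucciResponse
  rcases le_or_gt y 0 with hy | hy
  · rw [max_eq_right hy, min_eq_left hy, zero_div, zero_add]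
    split_ifs with h
    · constructor
      · intro he
        field_simp
        linarith
      · rintro rfl
        field_simp
        ring
    · constructor
      · intro he
        nlinarith [mul_neg_of_pos_of_neg hLam (not_le.1 h)]
      · rintro rfl
        refine absurd ?_ h
        have := div_nonpos_of_nonpos_of_nonneg hy hlam.le
        simpa using this
  · rw [max_eq_left hy.le, min_eq_right hy.le, zero_div, add_zero]
    split_ifs with h
    · constructor
      · intro he
        nlinarith [mul_nonneg hlam.le h]
      · rintro rfl
        have := div_pos hy hLam
        linarith
    · constructor
      · intro he
        field_simp
        linarith
      · rintro rfl
        field_simp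
        ring

theorem exists_lipschitzWith_pucciResponse (lam Lam : ℝ) :
    ∃ K, LipschitzWith K (pucciResponse lam Lam) := by
  have h1 : LipschitzWith 1 fun y : ℝ => max y 0 := LipschitzWith.id.max_const 0
  have h2 : LipschitzWith 1 fun y : ℝ => min y 0 := LipschitzWith.id.min_const 0
  have h := ((lipschitzWith_smul Lam⁻¹).comp h1).add ((lipschitzWith_smul lam⁻¹).comp h2)
  have heq : pucciResponse lam Lam = fun y => Lam⁻¹ • max y 0 + lam⁻¹ • min y 0 :=
    funext fun y => by simp [pucciResponse, div_eq_inv_mul]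
  rw [heq]
  exact ⟨_, h⟩

theorem pucciResponse_pos (hLam : 0 < Lam) {y : ℝ} (hy : 0 < y) :
    0 < pucciResponse lam Lam y := by
  rw [pucciResponse, max_eq_left hy.le, min_eq_right hy.le, zero_div, add_zero]
  exact div_pos hy hLam

theorem pucciResponse_neg_le (hlam : 0 < lam) (hle : lam ≤ Lam) {y : ℝ} (hy : 0 ≤ y) :
    pucciResponse lam Lam (-y) ≤ -pucciResponse lam Lam y := by
  have hy' : -y ≤ 0 := neg_nonpos.2 hy
  rw [pucciResponse, pucciResponse, max_eq_left hy, min_eq_right hy, max_eq_right hy',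
    min_eq_left hy', zero_div, zero_div, add_zero, zero_add, neg_div]
  exact neg_le_neg (div_le_div_of_nonneg_left hy hlam hle)

end pucciResponse

theorem isOpen_setOf_pos_coe_lt (R : EReal) : IsOpen {r : ℝ | 0 < r ∧ (r : EReal) < R} :=
  (isOpen_Ioi (a := (0 : ℝ))).inter (isOpen_Iio.preimage continuous_coe_real_ereal)

/-- Two-sided differentiability of `deriv u` at `0` makes `deriv u` continuous there, so that
`deriv u 0` is the right derivative of `u` even if `u` is not differentiable at `0`. -/
theorem contDiffOn_two_hasDeriv {R : EReal} {u : ℝ → ℝ}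
    (hu : ContDiffOn ℝ 2 u {r : ℝ | 0 ≤ r ∧ (r : EReal) < R})
    (h0 : DifferentiableAt ℝ (deriv u) 0) {r : ℝ} (hr : 0 ≤ r) (hrR : (r : EReal) < R) :
    HasDerivWithinAt u (deriv u r) (Ici r) r ∧
      HasDerivAt (deriv u) (deriv (deriv u) r) r := by
  have hO := isOpen_setOf_pos_coe_lt R
  have huO : ContDiffOn ℝ 2 u {r : ℝ | 0 < r ∧ (r : EReal) < R} :=
    hu.mono fun x hx => ⟨hx.1.le, hx.2⟩
  rcases hr.eq_or_lt with rfl | hpos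
  · refine ⟨?_, h0.hasDerivAt⟩
    refine hasDerivWithinAt_Ici_of_tendsto_deriv (s := {r : ℝ | 0 < r ∧ (r : EReal) < R})
      (huO.differentiableOn (by norm_num)) ?_ ?_
      (h0.continuousAt.tendsto.mono_left nhdsWithin_le_nhds)
    · exact (hu.continuousOn 0 ⟨le_rfl, hrR⟩).mono fun x hx => ⟨hx.1.le, hx.2⟩
    · exact inter_mem self_mem_nhdsWithin (nhdsWithin_le_nhds
        ((isOpen_Iio.preimage continuous_coe_real_ereal).mem_nhds hrR))
  · have hmem := hO.mem_nhds (⟨hpos, hrR⟩ : r ∈ {r : ℝ | 0 < r ∧ (r : EReal) < R})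
    have hd : ContDiffOn ℝ 1 (deriv u) {r : ℝ | 0 < r ∧ (r : EReal) < R} :=
      huO.deriv_of_isOpen hO (by norm_num)
    exact ⟨((huO.differentiableOn (by norm_num)).differentiableAt hmem).hasDerivAt.hasDerivWithinAt,
      ((hd.differentiableOn (by norm_num)).differentiableAt hmem).hasDerivAt⟩

theorem newton_eqOn_Icc {h : ℝ → ℝ} (hh : LocallyLipschitz h) {u w v z : ℝ → ℝ} {b : ℝ}
    (huc : ContinuousOn u (Icc 0 b)) (hwc : ContinuousOn w (Icc 0 b))
    (hu : ∀ t ∈ Ico 0 b, HasDerivWithinAt u (w t) (Ici t) t)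
    (hw : ∀ t ∈ Ico 0 b, HasDerivWithinAt w (-h (u t)) (Ici t) t)
    (hv : ∀ t, HasDerivAt v (z t) t) (hz : ∀ t, HasDerivAt z (-h (v t)) t)
    (huv : u 0 = v 0) (hwz : w 0 = z 0) : EqOn u v (Icc 0 b) := by
  have hvc : Continuous v := continuous_iff_continuousAt.2 fun x => (hv x).continuousAt
  have hzc : Continuous z := continuous_iff_continuousAt.2 fun x => (hz x).continuousAt
  obtain ⟨B₁, hB₁⟩ := isCompact_Icc.exists_bound_of_continuousOn huc
  obtain ⟨B₂, hB₂⟩ := isCompact_Icc.exists_bound_of_continuousOn hvc.continuousOn (s := Icc 0 b)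
  set B := max B₁ B₂
  obtain ⟨K, hK⟩ := (hh.locallyLipschitzOn (s := Icc (-B) B)).exists_lipschitzOnWith_of_compact
    isCompact_Icc
  have hF : LipschitzOnWith (max 1 K) (fun p : ℝ × ℝ => (p.2, -h p.1)) {p | p.1 ∈ Icc (-B) B} :=
    LipschitzWith.prod_snd.lipschitzOnWith.prodMk
      (mul_one K ▸ (hK.comp (LipschitzWith.prod_fst (β := ℝ)).lipschitzOnWith fun p hp => hp).neg)
  have key := ODE_solution_unique_of_mem_Icc_right (v := fun _ (p : ℝ × ℝ) => (p.2, -h p.1))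
    (s := fun _ => {p | p.1 ∈ Icc (-B) B}) (f := fun t => (u t, w t)) (g := fun t => (v t, z t))
    (a := 0) (b := b) (fun _ _ => hF) (huc.prodMk hwc) (fun t ht => (hu t ht).prodMk (hw t ht))
    (fun t ht => abs_le.1 ((hB₁ t (Ico_subset_Icc_self ht)).trans (le_max_left _ _)))
    (hvc.prodMk hzc).continuousOn
    (fun t _ => ((hv t).prodMk (hz t)).hasDerivWithinAt)
    (fun t ht => abs_le.1 ((hB₂ t (Ico_subset_Icc_self ht)).trans (le_max_right _ _)))
    (by simp [huv, hwz])
  exact fun t ht => congrArg Prod.fst (key ht)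

theorem exists_global_pucci_oscillation {lam Lam : ℝ} (hlam : 0 < lam) (hlamLam : lam ≤ Lam)
    {g : ℝ → ℝ} (hg : LocallyLipschitz g) (hgodd : ∀ t, g (-t) = -g t) {α ξ : ℝ}
    (hgpos : ∀ t, 0 < t → t < α → 0 < g t) (hξ0 : 0 < ξ) (hξα : ξ < α) :
    ∃ v z : ℝ → ℝ, v 0 = ξ ∧ z 0 = 0 ∧ (∀ t, HasDerivAt v (z t) t) ∧
      (∀ t, HasDerivAt z (-pucciResponse lam Lam (g (v t))) t) ∧ (∀ t, |v t| ≤ ξ) ∧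
      (∃ t, v t = 0) ∧ ∃ T, 0 < T ∧ Function.Periodic v T := by
  have hLam : 0 < Lam := hlam.trans_le hlamLam
  obtain ⟨Kφ, hφ⟩ := exists_lipschitzWith_pucciResponse lam Lam
  have hh : LocallyLipschitz fun t => pucciResponse lam Lam (g t) := hφ.locallyLipschitz.comp hg
  set c : ℝ → ℝ := fun t => max (-ξ) (min t ξ) with hc
  have hcmem : ∀ t, c t ∈ Icc (-ξ) ξ := fun t =>
    ⟨le_max_left _ _, max_le (by linarith) (min_le_right _ _)⟩
  have hceq : ∀ t, |t| ≤ ξ → c t = t := fun t ht => by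
    rw [hc]
    simp only
    rw [min_eq_left (abs_le.1 ht).2, max_eq_right (abs_le.1 ht).1]
  have hcneg : ∀ t, c (-t) = -c t := fun t => by
    simp only [hc]
    grind
  have hcpos : ∀ t, 0 < t → 0 < c t := fun t ht => lt_max_of_lt_right (lt_min ht hξ0)
  have hc0 : ∀ t, 0 ≤ t → 0 ≤ c t := fun t ht => le_max_of_le_right (le_min ht hξ0.le)
  have hcg : ∀ t, 0 < t → 0 < g (c t) := fun t ht =>
    hgpos _ (hcpos t ht) ((hcmem t).2.trans_lt hξα)
  have hg0 : g 0 = 0 := by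
    have := hgodd 0
    rw [neg_zero] at this
    linarith
  have hcl : LipschitzWith 1 c := (LipschitzWith.id.min_const ξ).const_max (-ξ)
  obtain ⟨K, hK⟩ := (hh.locallyLipschitzOn (s := Icc (-ξ) ξ)).exists_lipschitzOnWith_of_compact
    isCompact_Icc
  obtain ⟨B, hB⟩ := isCompact_Icc.exists_bound_of_continuousOn
    (hh.continuous.continuousOn (s := Icc (-ξ) ξ))
  set q : ℝ → ℝ := fun t => pucciResponse lam Lam (g (c t)) with hq
  have hqL : LipschitzWith K q := by
    rw [← lipschitzOnWith_univ]
    exact mul_one K ▸ hK.comp hcl.lipschitzOnWith fun t _ => hcmem t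
  have hqB : ∀ t, |q t| ≤ B.toNNReal := fun t => (hB _ (hcmem t)).trans (Real.le_coe_toNNReal B)
  have hqpos : ∀ s, 0 < s → 0 < q s := fun s hs => pucciResponse_pos hLam (hcg s hs)
  have hqodd : ∀ s, 0 ≤ s → q (-s) ≤ -q s := fun s hs => by
    simp only [hq]
    rw [hcneg, hgodd]
    refine pucciResponse_neg_le hlam hlamLam ?_
    rcases hs.eq_or_lt with rfl | hs
    · rw [hceq 0 (by simpa using hξ0.le), hg0]
    · exact (hcg s hs).le
  obtain ⟨v, z, hv0, hz0, hv, hz⟩ := exists_global_newton hqL hqB ξ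
  have hle := newton_abs_le hqL.continuous hqpos hqodd hξ0 hv0 hz0 hv hz
  obtain ⟨t, -, ht⟩ := newton_exists_zero hqpos hξ0 hv0 hz0 hv hz
  refine ⟨v, z, hv0, hz0, hv, fun t => ?_, hle, ⟨t, ht⟩,
    newton_periodic hqL hqpos hqodd hξ0 hv0 hz0 hv hz⟩
  have := hz t
  simp only [hq] at this
  rwa [hceq _ (hle t)] at this

theorem pucci_1d_minus_positive_data
    (lam Lam : ℝ) (hlam : 0 < lam) (hlamLam : lam ≤ Lam)
    (g : ℝ → ℝ) (hg1 : LocallyLipschitz g)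
    (hg2 : ∀ t, g (-t) = - g t)
    (α : ℝ) (hα : 0 < α)
    (hg3pos : ∀ t, 0 < t → t < α → 0 < g t)
    (hg3neg : ∀ t, α < t → g t < 0)
    (G : ℝ → ℝ) (hG : ∀ t, G t = ∫ s in (0:ℝ)..t, g s)
    (ξ : ℝ) (hξ0 : 0 < ξ) (hξα : ξ < α)
    (R : EReal) (hR : 0 < R)
    (u : ℝ → ℝ)
    (hu : ContDiffOn ℝ 2 u {r : ℝ | 0 ≤ r ∧ (r : EReal) < R})
    (hode : ∀ r : ℝ, 0 ≤ r → (r : EReal) < R →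
      (if 0 ≤ deriv (deriv u) r then lam * deriv (deriv u) r
        else Lam * deriv (deriv u) r) + g (u r) = 0)
    (hu0 : u 0 = ξ) (hu'0 : deriv u 0 = 0)
    (hmax : ¬ ∃ (R' : EReal) (v : ℝ → ℝ), R < R' ∧
      ContDiffOn ℝ 2 v {r : ℝ | 0 ≤ r ∧ (r : EReal) < R'} ∧
      (∀ r : ℝ, 0 ≤ r → (r : EReal) < R' →
        (if 0 ≤ deriv (deriv v) r then lam * deriv (deriv v) r
        else Lam * deriv (deriv v) r) + g (v r) = 0) ∧
      v 0 = ξ ∧ deriv v 0 = 0 ∧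
      (∀ r : ℝ, 0 ≤ r → (r : EReal) < R → v r = u r))
 :
    R = ⊤ ∧
    (∀ M : ℝ, ∃ r, M ≤ r ∧ u r = 0) ∧
    (∃ T > 0, ∀ r, 0 ≤ r → u (r + T) = u r) ∧
    sSup ((fun r => |u r|) '' Set.Ici 0) = ξ := by
  have hLam : 0 < Lam := hlam.trans_le hlamLam
  obtain ⟨v, z, hv0, hz0, hv, hz, hle, ⟨t₀, ht₀⟩, T, hT, hper⟩ :=
    exists_global_pucci_oscillation hlam hlamLam hg1 hg2 hg3pos hξ0 hξα
  obtain ⟨Kφ, hφ⟩ := exists_lipschitzWith_pucciResponse lam Lam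
  have hh : LocallyLipschitz fun t => pucciResponse lam Lam (g t) := hφ.locallyLipschitz.comp hg1
  have hode' : ∀ r : ℝ, 0 ≤ r → (r : EReal) < R →
      deriv (deriv u) r = -pucciResponse lam Lam (g (u r)) := fun r hr hrR =>
    (pucci_add_eq_zero_iff hlam hLam _ _).1 (hode r hr hrR)
  have hd0 : DifferentiableAt ℝ (deriv u) 0 := by
    refine differentiableAt_of_deriv_ne_zero ?_
    rw [hode' 0 le_rfl hR, hu0]
    linarith [pucciResponse_pos (lam := lam) hLam (hg3pos ξ hξ0 hξα)]
  have huv : ∀ r : ℝ, 0 ≤ r → (r : EReal) < R → u r = v r := by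
    intro r hr hrR
    have hsub : ∀ t ∈ Icc 0 r, 0 ≤ t ∧ (t : EReal) < R := fun t ht =>
      ⟨ht.1, (EReal.coe_le_coe_iff.2 ht.2).trans_lt hrR⟩
    have hder := fun t ht => contDiffOn_two_hasDeriv hu hd0 (hsub t ht).1 (hsub t ht).2
    refine newton_eqOn_Icc hh (u := u) (w := deriv u) (hu.continuousOn.mono hsub)
      (fun t ht => (hder t ht).2.continuousAt.continuousWithinAt)
      (fun t ht => (hder t (Ico_subset_Icc_self ht)).1) (fun t ht => ?_) hv hz
      (by rw [hu0, hv0]) (by rw [hu'0, hz0]) ⟨hr, le_rfl⟩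
    have ht' := hsub t (Ico_subset_Icc_self ht)
    rw [← hode' t ht'.1 ht'.2]
    exact (hder t (Ico_subset_Icc_self ht)).2.hasDerivWithinAt
  have hdv : deriv v = z := funext fun t => (hv t).deriv
  have hddv : deriv z = fun t => -pucciResponse lam Lam (g (v t)) := funext fun t => (hz t).deriv
  have hvc : Continuous v := continuous_iff_continuousAt.2 fun x => (hv x).continuousAt
  have hvC : ContDiff ℝ 2 v := by
    rw [show (2 : WithTop ℕ∞) = 1 + 1 by norm_num, contDiff_succ_iff_deriv, hdv,
      contDiff_one_iff_deriv, hddv]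
    exact ⟨fun t => (hv t).differentiableAt, by simp, fun t => (hz t).differentiableAt,
      (hh.continuous.comp hvc).neg⟩
  have hRtop : R = ⊤ := by
    by_contra hne
    refine hmax ⟨⊤, v, lt_top_iff_ne_top.2 hne, hvC.contDiffOn, fun r _ _ => ?_, hv0,
      by rw [hdv, hz0], fun r hr hrR => (huv r hr hrR).symm⟩
    rw [pucci_add_eq_zero_iff hlam hLam, hdv, hddv]
  have huv' : ∀ r : ℝ, 0 ≤ r → u r = v r := fun r hr =>
    huv r hr (by rw [hRtop]; exact EReal.coe_lt_top r)
  refine ⟨hRtop, fun M => ?_, ⟨T, hT, fun r hr => ?_⟩, ?_⟩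
  · obtain ⟨n, hn⟩ := exists_nat_ge ((max M 0 - t₀) / T)
    have hn' : max M 0 ≤ t₀ + n * T := by
      rw [div_le_iff₀ hT] at hn
      linarith
    refine ⟨t₀ + n * T, (le_max_left _ _).trans hn', ?_⟩
    rw [huv' _ ((le_max_right _ _).trans hn'), hper.nat_mul n t₀, ht₀]
  · rw [huv' r hr, huv' (r + T) (by linarith), hper r]
  · refine IsGreatest.csSup_eq ⟨⟨0, self_mem_Ici, by simp [hu0, abs_of_pos hξ0]⟩, ?_⟩
    rintro _ ⟨r, hr, rfl⟩
    simpa only [huv' r hr] using hle r
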